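/- arXiv:2502.00759 — 2 statements merged into one kernel-verified Lean document; each statement's English description precedes it below -/
import Mathlib

section
/- Double-ball integral bound for regularly varying mass functions (Lemma 4.3). Let d ≥ 1 and let K : ℝ^d → ℝ be locally integrable. Define w_t := ∫_{|z| ≤ t} K(z) dz for t > 0. Assume t ↦ w_t is regularly varying at infinity and that the limit w_∞ := lim_{t→∞} w_t exists in (0, ∞]. Fix a > 0. Then for every δ > 0 there exist a constant X > 0 and a finite constant C (depending only on δ, K and a) such that for all t₂ ≥ t₁ ≥ X, ∫_{|x| ≤ a t₁} ∫_{|y| ≤ a t₂} K(x − y) dx dy ≤ C · t₁^d · w_{t₂}. -/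
open MeasureTheory Filter

/-- A measurable function `L : (0,∞) → ℝ` is slowly varying at infinity if it is eventually
positive and `L(λt)/L(t) → 1` as `t → ∞` for every `λ > 0`. -/
def SlowlyVarying (L : ℝ → ℝ) : Prop :=
  Measurable L ∧ (∃ X₀ : ℝ, 0 < X₀ ∧ ∀ t, X₀ ≤ t → 0 < L t) ∧
    ∀ lam : ℝ, 0 < lam → Tendsto (fun t => L (lam * t) / L t) atTop (nhds 1)

/-- `f` is regularly varying at infinity (with some index `ρ`) if `f(t) = t^ρ L(t)` with `L`
slowly varying at infinity. -/
def RegularlyVarying (f : ℝ → ℝ) : Prop :=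
  ∃ ρ : ℝ, ∃ L : ℝ → ℝ, SlowlyVarying L ∧ ∀ t : ℝ, 0 < t → f t = t ^ ρ * L t


lemma dbi_bad (h : ℝ → ℝ) (hm : Measurable h)
    (hh : ∀ v, Tendsto (fun u => h (u + v) - h u) atTop (nhds 0)) (ε : ℝ) (hε : 0 < ε)
    (u : ℕ → ℝ) (hu : Tendsto u atTop atTop) :
    Tendsto (fun n => volume ({s : ℝ | ε ≤ |h (u n + s) - h (u n)|} ∩ Set.Icc 0 2)) atTop (nhds 0) := by
  have h1 : TendstoInMeasure (volume.restrict (Set.Icc (0:ℝ) 2))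
      (fun n s => h (u n + s) - h (u n)) atTop (fun _ => (0:ℝ)) := by
    apply tendstoInMeasure_of_tendsto_ae
    · intro n
      exact ((hm.comp (measurable_const_add _)).sub_const _).aestronglyMeasurable
    · exact Eventually.of_forall fun s => (hh s).comp hu
  rw [tendstoInMeasure_iff_norm] at h1
  refine (h1 ε hε).congr fun n => ?_
  rw [Measure.restrict_apply' measurableSet_Icc]
  simp [Real.norm_eq_abs]

lemma dbi_uct (h : ℝ → ℝ) (hm : Measurable h)
    (hh : ∀ v, Tendsto (fun u => h (u + v) - h u) atTop (nhds 0)) (ε : ℝ) (hε : 0 < ε) :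
    ∃ U, ∀ u ≥ U, ∀ v ∈ Set.Icc (0:ℝ) 1, |h (u + v) - h u| ≤ ε := by
  by_contra hcon
  push Not at hcon
  choose u hu v hv huv using fun n : ℕ => hcon n
  have hu1 : Tendsto u atTop atTop :=
    tendsto_atTop_mono hu tendsto_natCast_atTop_atTop
  have hu2 : Tendsto (fun n => u n + v n) atTop atTop :=
    tendsto_atTop_mono (fun n => le_add_of_nonneg_right (hv n).1) hu1
  have b1 := dbi_bad h hm hh (ε/2) (half_pos hε) u hu1
  have b2 := dbi_bad h hm hh (ε/2) (half_pos hε) _ hu2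
  have b3 := b1.add b2
  rw [add_zero] at b3
  obtain ⟨n, hn⟩ := (b3.eventually (gt_mem_nhds (show (0:ENNReal) < 1 by simp))).exists
  have hsub : Set.Icc (1:ℝ) 2 ⊆ ({s : ℝ | ε/2 ≤ |h (u n + s) - h (u n)|} ∩ Set.Icc 0 2) ∪
      (fun s => s + (- v n)) ⁻¹' ({s : ℝ | ε/2 ≤ |h (u n + v n + s) - h (u n + v n)|} ∩ Set.Icc 0 2) := by
    intro s hs
    by_contra hc
    have hv1 := (hv n).1
    have hv2 := (hv n).2
    have hs1 := hs.1
    have hs2 := hs.2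
    simp only [Set.mem_union, Set.mem_inter_iff, Set.mem_ofPred_eq, Set.mem_preimage, not_or, not_and,
      Set.mem_Icc] at hc
    obtain ⟨c1, c2⟩ := hc
    have d1 : |h (u n + s) - h (u n)| < ε/2 := by
      by_contra! hx
      exact c1 hx (by linarith) (by linarith)
    have d2 : |h (u n + v n + (s + -v n)) - h (u n + v n)| < ε/2 := by
      by_contra! hx
      exact c2 hx (by linarith) (by linarith)
    rw [show u n + v n + (s + -v n) = u n + s by ring] at d2
    have := huv n
    rw [abs_lt] at d1 d2
    rcases lt_abs.1 this with h' | h' <;> linarith [d1.1, d1.2, d2.1, d2.2]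
  have := (measure_mono hsub).trans (measure_union_le (μ := volume) _ _)
  rw [measure_preimage_add_right, Real.volume_Icc] at this
  norm_num at this
  exact absurd hn (not_lt.2 this)

lemma dbi_potter0 (h : ℝ → ℝ) (ε U : ℝ) (hε : 0 < ε)
    (hU : ∀ u ≥ U, ∀ v ∈ Set.Icc (0:ℝ) 1, |h (u + v) - h u| ≤ ε) (u : ℝ) (hu : U ≤ u) (v : ℝ) (hv : 0 ≤ v) :
    |h (u + v) - h u| ≤ ε * (v + 1) := by
  have key : ∀ n : ℕ, |h (u + n) - h u| ≤ ε * n := by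
    intro n
    induction n with
    | zero => simp
    | succ n ih =>
      have h1 := hU (u + n) (by have : (0:ℝ) ≤ n := n.cast_nonneg
                                linarith) 1 (by simp)
      push_cast
      rw [← add_assoc]
      calc _ = |(h (u + n + 1) - h (u + n)) + (h (u + n) - h u)| := by congr 1; ring
        _ ≤ _ := abs_add_le _ _
        _ ≤ _ := by linarith
  have hf := Nat.floor_le hv
  have hf2 := Nat.lt_floor_add_one v
  have h1 := hU (u + ⌊v⌋₊) (by linarith [(Nat.cast_nonneg ⌊v⌋₊ : (0:ℝ) ≤ _)]) (v - ⌊v⌋₊) ⟨by linarith, by linarith⟩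
  rw [show u + ⌊v⌋₊ + (v - ⌊v⌋₊) = u + v by ring] at h1
  calc _ = |(h (u + v) - h (u + ⌊v⌋₊)) + (h (u + ⌊v⌋₊) - h u)| := by congr 1; ring
        _ ≤ _ := abs_add_le _ _
        _ ≤ ε + ε * ⌊v⌋₊ := add_le_add h1 (key _)
        _ ≤ _ := by nlinarith

lemma dbi_potter (L : ℝ → ℝ) (hL : SlowlyVarying L) : ∃ X : ℝ, 0 < X ∧ ∀ s, X ≤ s → 0 < L s ∧
    ∀ t, s ≤ t → L t ≤ Real.exp (1/2) * (t / s) ^ (1/2 : ℝ) * L s ∧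
      L s ≤ Real.exp (1/2) * (t / s) ^ (1/2 : ℝ) * L t := by
  obtain ⟨hm, ⟨X₀, hX₀, hpos⟩, hlim⟩ := hL
  have hh : ∀ v, Tendsto (fun u => Real.log (L (Real.exp (u + v))) - Real.log (L (Real.exp u))) atTop (nhds 0) := by
    intro v
    have h1 := (hlim (Real.exp v) (Real.exp_pos v)).comp Real.tendsto_exp_atTop
    have h2 := h1.log one_ne_zero
    rw [Real.log_one] at h2
    refine h2.congr' ?_
    filter_upwards [Real.tendsto_exp_atTop.eventually_ge_atTop X₀, (Real.tendsto_exp_atTop.comp (tendsto_atTop_add_const_right _ v tendsto_id)).eventually_ge_atTop X₀] with u h3 h4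
    simp only [Function.comp, id] at h4 ⊢
    rw [← Real.exp_add, add_comm v u, Real.log_div (hpos _ h4).ne' (hpos _ h3).ne']
  obtain ⟨U, hU⟩ := dbi_uct (fun u => Real.log (L (Real.exp u))) (Real.measurable_log.comp (hm.comp Real.measurable_exp)) hh (1/2) (by norm_num)
  refine ⟨max X₀ (Real.exp U), by positivity, fun s hs => ?_⟩
  have hs1 := (le_max_left _ _).trans hs
  have hs2 := (le_max_right _ _).trans hs
  have hs0 : 0 < s := hX₀.trans_le hs1
  refine ⟨hpos s hs1, fun t ht => ?_⟩
  have ht0 := hs0.trans_le ht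
  have hLs := hpos s hs1
  have hLt := hpos t (hs1.trans ht)
  have hv : 0 ≤ Real.log t - Real.log s := sub_nonneg.2 (Real.log_le_log hs0 ht)
  have := dbi_potter0 (fun u => Real.log (L (Real.exp u))) (1/2) U (by norm_num) hU (Real.log s) ((Real.le_log_iff_exp_le hs0).2 hs2) (Real.log t - Real.log s) hv
  simp only [add_sub_cancel, Real.exp_log hs0, Real.exp_log ht0] at this
  rw [abs_le] at this
  have e : ∀ x, 0 < x → Real.exp (1/2) * (t / s) ^ (1/2 : ℝ) * x = Real.exp (1/2 * (Real.log t - Real.log s + 1) + Real.log x) := by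
    intro x hx
    rw [Real.rpow_def_of_pos (by positivity), Real.log_div ht0.ne' hs0.ne']
    nth_rewrite 1 [← Real.exp_log hx]
    rw [← Real.exp_add, ← Real.exp_add]
    congr 1; ring
  rw [e _ hLs, e _ hLt]
  constructor
  · rw [← Real.log_le_iff_le_exp hLt]; linarith
  · rw [← Real.log_le_iff_le_exp hLs]; linarith
lemma dbi_anti (d : ℕ) (p q : ℝ) (z z' : EuclideanSpace ℝ (Fin d)) (hz : ‖z'‖ ≤ ‖z‖) :
    volume (Metric.closedBall (0 : EuclideanSpace ℝ (Fin d)) p ∩ Metric.closedBall z q) ≤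
    volume (Metric.closedBall (0 : EuclideanSpace ℝ (Fin d)) p ∩ Metric.closedBall z' q) := by
  rcases eq_or_ne z z' with rfl | hne
  · rfl
  set v := z - z' with hv
  have hv0 : v ≠ 0 := sub_ne_zero.2 hne
  have hvn : 0 < ‖v‖ ^ 2 := by positivity
  set m := (1/2 : ℝ) • (z + z') with hm
  set ρ := (Submodule.span ℝ {v})ᗮ.reflection with hρ
  have hρa : ∀ x, ρ x = x - (2 * (inner ℝ v x / ‖v‖ ^ 2)) • v := by
    intro x
    rw [hρ, Submodule.reflection_orthogonal_apply, Submodule.reflection_singleton_apply]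
    simp only [RCLike.ofReal_real_eq_id, id, neg_sub, two_smul, two_mul, add_smul]
  have hzm : z - m = (1/2 : ℝ) • v := by rw [hm, hv]; module
  have hzm' : z' - m = -((1/2 : ℝ) • v) := by rw [hm, hv]; module
  have hρv : ρ v = -v := Submodule.reflection_orthogonalComplement_singleton_eq_neg v
  let σ : EuclideanSpace ℝ (Fin d) → EuclideanSpace ℝ (Fin d) := fun x => ρ (x - m) + m
  have hσ : MeasurePreserving σ volume volume :=
    (measurePreserving_add_right volume m).comp
      (ρ.measurePreserving.comp (measurePreserving_sub_right volume m))
  have h1 : ∀ x, ‖σ x - z'‖ = ‖x - z‖ := by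
    intro x
    have : σ x - z' = ρ (x - z) := by
      have : x - z = (x - m) - (z - m) := by abel
      rw [this, map_sub, hzm, map_smul, hρv]
      have : σ x - z' = ρ (x - m) - (z' - m) := by simp only [σ]; abel
      rw [this, hzm']; simp
    rw [this, ρ.norm_map]
  have h2 : ∀ x, ‖σ x - z‖ = ‖x - z'‖ := by
    intro x
    have : σ x - z = ρ (x - z') := by
      have : x - z' = (x - m) - (z' - m) := by abel
      rw [this, map_sub, hzm', map_neg, map_smul, hρv]
      have : σ x - z = ρ (x - m) - (z - m) := by simp only [σ]; abel
      rw [this, hzm]; simp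
    rw [this, ρ.norm_map]
  have h3 : ∀ x, ‖x - z‖ ≤ ‖x - z'‖ → ‖σ x‖ ≤ ‖x‖ := by
    intro x hx
    have e1 : ‖x - z‖ ^ 2 ≤ ‖x - z'‖ ^ 2 := by gcongr
    have e2 : ‖z'‖ ^ 2 ≤ ‖z‖ ^ 2 := by gcongr
    rw [norm_sub_sq_real, norm_sub_sq_real] at e1
    have e3 : inner ℝ v m = (‖z‖ ^ 2 - ‖z'‖ ^ 2) / 2 := by
      rw [hv, hm, inner_smul_right, inner_sub_left, inner_add_right, inner_add_right,
        real_inner_self_eq_norm_sq, real_inner_self_eq_norm_sq, real_inner_comm z z']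
      ring
    have e4 : inner ℝ v x = inner ℝ x z - inner ℝ x z' := by
      rw [hv, inner_sub_left, real_inner_comm, real_inner_comm x z']
    have e5 : inner ℝ v (x - m) = inner ℝ v x - inner ℝ v m := inner_sub_right _ _ _
    have e6 : 0 ≤ inner ℝ v (x - m) := by rw [e5, e3, e4]; linarith
    set c := 2 * (inner ℝ v (x - m) / ‖v‖ ^ 2) with hc
    have hc0 : 0 ≤ c := by positivity
    have hcv : c * ‖v‖ ^ 2 = 2 * inner ℝ v (x - m) := by rw [hc]; field_simp
    have e7 : σ x = x - c • v := by
      simp only [σ]; rw [hρa]; abel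
    have e8 : ‖σ x‖ ^ 2 = ‖x‖ ^ 2 - 2 * c * inner ℝ v m := by
      rw [e7, norm_sub_sq_real, inner_smul_right, norm_smul, mul_pow, Real.norm_eq_abs, sq_abs,
        real_inner_comm]
      linear_combination c * hcv + 2 * c * e5
    have e9 : 0 ≤ c * inner ℝ v m := mul_nonneg hc0 (by rw [e3]; linarith)
    exact le_of_sq_le_sq (by linarith) (norm_nonneg _)
  set A := Metric.closedBall (0 : EuclideanSpace ℝ (Fin d)) p
  set B := Metric.closedBall z q
  set B' := Metric.closedBall z' q
  have hA : MeasurableSet A := Metric.isClosed_closedBall.measurableSet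
  have hB : MeasurableSet B := Metric.isClosed_closedBall.measurableSet
  have hB' : MeasurableSet B' := Metric.isClosed_closedBall.measurableSet
  have hsub : (A ∩ B) \ B' ⊆ σ ⁻¹' ((A ∩ B') \ B) := by
    rintro x ⟨⟨hxA, hxB⟩, hxB'⟩
    simp only [A, B, B', Metric.mem_closedBall, dist_eq_norm, sub_zero, not_le, Set.mem_preimage, Set.mem_sdiff,
      Set.mem_inter_iff, h1, h2] at *
    exact ⟨⟨(h3 x (hxB.trans hxB'.le)).trans hxA, hxB⟩, hxB'⟩
  have hle : volume ((A ∩ B) \ B') ≤ volume ((A ∩ B') \ B) :=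
    (measure_mono hsub).trans_eq (hσ.measure_preimage (MeasurableSet.diff (hA.inter hB') hB).nullMeasurableSet)
  rw [← measure_inter_add_sdiff (A ∩ B) hB', ← measure_inter_add_sdiff (A ∩ B') hB, Set.inter_right_comm A B B']
  gcongr

lemma dbi_swap {α β : Type*} [MeasurableSpace α] [MeasurableSpace β] (μ : Measure α) (ν : Measure β)
    [IsFiniteMeasure μ] [SFinite ν] (K : β → ℝ) (hK : Integrable K ν) (S : Set (α × β)) (hS : MeasurableSet S) :
    Integrable (fun x => ∫ z in {z | (x, z) ∈ S}, K z ∂ν) μ ∧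
    ∫ x, ∫ z in {z | (x, z) ∈ S}, K z ∂ν ∂μ = ∫ z, K z * μ.real {x | (x, z) ∈ S} ∂ν := by
  have hI : Integrable (S.indicator (fun y : α × β => K y.2)) (μ.prod ν) :=
    (hK.comp_snd μ).indicator hS
  have e : ∀ x, ∫ z in {z | (x, z) ∈ S}, K z ∂ν = ∫ z, S.indicator (fun y : α × β => K y.2) (x, z) ∂ν := by
    intro x
    have hm : MeasurableSet {z | (x, z) ∈ S} := measurable_prodMk_left hS
    rw [← integral_indicator hm]
    rfl
  simp_rw [e]
  refine ⟨hI.integral_prod_left, ?_⟩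
  rw [integral_integral_swap (f := fun x z => S.indicator (fun y : α × β => K y.2) (x, z)) hI]
  congr 1 with z
  have hm : MeasurableSet {x | (x, z) ∈ S} := measurable_prodMk_right hS
  have : ∫ x, S.indicator (fun y : α × β => K y.2) (x, z) ∂μ = ∫ x, {x | (x, z) ∈ S}.indicator (fun _ => K z) x ∂μ := rfl
  rw [this, integral_indicator hm]
  simp [mul_comm]

lemma dbi_set (d : ℕ) (hd : 1 ≤ d) (S : Set (EuclideanSpace ℝ (Fin d)))
    (hS : ∀ z ∈ S, ∀ z', ‖z'‖ ≤ ‖z‖ → z' ∈ S) (r P : ℝ) (hr : 0 < r)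
    (h1 : Metric.ball 0 r ⊆ S) (h2 : S ⊆ Metric.closedBall 0 P) :
    ∃ R, r ≤ R ∧ R ≤ P ∧ S =ᵐ[volume] Metric.closedBall (0 : EuclideanSpace ℝ (Fin d)) R := by
  have : Nonempty (Fin d) := ⟨⟨0, hd⟩⟩
  have : Nontrivial (EuclideanSpace ℝ (Fin d)) := inferInstance
  have hb : BddAbove (norm '' S) := ⟨P, by
    rintro _ ⟨z, hz, rfl⟩
    simpa using h2 hz⟩
  have hne : (norm '' S).Nonempty := ⟨_, 0, h1 (Metric.mem_ball_self hr), rfl⟩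
  have hrR : r ≤ sSup (norm '' S) := by
    apply le_of_forall_lt
    intro c hc
    have hc' : max c 0 < r := max_lt hc hr
    obtain ⟨c', h3, h4⟩ := exists_between hc'
    obtain ⟨z, hz⟩ := exists_norm_eq (EuclideanSpace ℝ (Fin d)) ((le_max_right c 0).trans h3.le)
    refine (le_max_left c 0).trans_lt (h3.trans_le (le_csSup hb ⟨z, h1 ?_, hz⟩))
    simpa [hz] using h4
  refine ⟨sSup (norm '' S), hrR, csSup_le hne ?_, ?_⟩
  · rintro _ ⟨z, hz, rfl⟩
    simpa using h2 hz
  · have hsub : S ⊆ Metric.closedBall 0 (sSup (norm '' S)) := fun z hz => by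
      simpa using le_csSup hb ⟨z, hz, rfl⟩
    refine hsub.eventuallyLE.antisymm ?_
    have : Metric.closedBall 0 (sSup (norm '' S)) \ S ⊆ Metric.sphere 0 (sSup (norm '' S)) := by
      rintro z ⟨hz, hzS⟩
      simp only [Metric.mem_closedBall, dist_zero_right, mem_sphere_iff_norm, sub_zero] at hz ⊢
      refine le_antisymm hz (not_lt.1 fun hlt => hzS ?_)
      obtain ⟨_, ⟨y, hy, rfl⟩, hlt'⟩ := exists_lt_of_lt_csSup hne hlt
      exact hS y hy z hlt'.le
    exact ae_le_set.2 (measure_mono_null this (Measure.addHaar_sphere volume _ _))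

lemma dbi_w (w L : ℝ → ℝ) (ρ : ℝ) (hLp : ∃ X : ℝ, 0 < X ∧ ∀ s, X ≤ s → 0 < L s ∧
    ∀ t, s ≤ t → L t ≤ Real.exp (1/2) * (t / s) ^ (1/2 : ℝ) * L s ∧
      L s ≤ Real.exp (1/2) * (t / s) ^ (1/2 : ℝ) * L t)
    (hL2 : Tendsto (fun t => L (2 * t) / L t) atTop (nhds 1))
    (hw : ∀ t, 0 < t → w t = t ^ ρ * L t)
    (hwlim : Tendsto w atTop atTop ∨ ∃ l : ℝ, 0 < l ∧ Tendsto w atTop (nhds l))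
    (hM : ∀ X, ∃ M, ∀ r, 0 < r → r ≤ X → w r ≤ M) (b : ℝ) :
    ∃ X : ℝ, 0 < X ∧ ∃ C : ℝ, 0 ≤ C ∧ ∀ t, X ≤ t → 0 < w t ∧ ∀ r, 0 < r → r ≤ b * t →
      w r ≤ C * w t * (1 + (t / r) ^ (1/2 : ℝ)) := by
  obtain ⟨X₀, hX₀, hP⟩ := hLp
  have hm : ∃ m, 0 < m ∧ ∃ X, 0 < X ∧ ∀ t, X ≤ t → m ≤ w t := by
    have : ∃ m, 0 < m ∧ ∀ᶠ t in atTop, m ≤ w t := by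
      rcases hwlim with h | ⟨l, hl, h⟩
      · exact ⟨1, one_pos, h.eventually_ge_atTop 1⟩
      · exact ⟨l/2, half_pos hl, h.eventually (le_mem_nhds (half_lt_self hl))⟩
    obtain ⟨m, hm, h⟩ := this
    obtain ⟨X, hX⟩ := eventually_atTop.1 h
    exact ⟨m, hm, max X 1, by positivity, fun t ht => hX t ((le_max_left _ _).trans ht)⟩
  obtain ⟨m, hm, X₁, hX₁, hmw⟩ := hm
  have hρ : 0 ≤ ρ := by
    by_contra! hρ
    have h2 : (2:ℝ) ^ ρ < 1 := Real.rpow_lt_one_of_one_lt_of_neg (by norm_num) hρ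
    obtain ⟨c, hc1, hc2⟩ := exists_between h2
    have hc0 : 0 < c := lt_trans (by positivity) hc1
    have h3 : Tendsto (fun t => (2:ℝ) ^ ρ * (L (2 * t) / L t)) atTop (nhds ((2:ℝ) ^ ρ)) := by
      simpa using hL2.const_mul ((2:ℝ)^ρ)
    obtain ⟨X, hX⟩ := eventually_atTop.1 (h3.eventually (ge_mem_nhds hc1))
    set T := max X (max X₀ X₁) with hT
    have hT0 : 0 < T := by positivity
    have key : ∀ t, T ≤ t → w (2 * t) ≤ c * w t := by
      intro t ht
      have h4 := hX t ((le_max_left _ _).trans ht)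
      have ht0 : 0 < t := hT0.trans_le ht
      have hLt := (hP t (((le_max_left _ _).trans (le_max_right _ _)).trans ht)).1
      rw [hw _ (by positivity), hw _ ht0, Real.mul_rpow (by norm_num) ht0.le]
      have : (2:ℝ)^ρ * L (2 * t) ≤ c * L t := by
        rwa [← mul_div_assoc, div_le_iff₀ hLt] at h4
      have htp : 0 < t ^ ρ := by positivity
      nlinarith
    have hn : ∀ n : ℕ, T ≤ 2 ^ n * T := fun n => le_mul_of_one_le_left hT0.le (one_le_pow₀ (by norm_num))
    have key2 : ∀ n : ℕ, w (2 ^ n * T) ≤ c ^ n * w T := by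
      intro n
      induction n with
      | zero => simp
      | succ n ih =>
        have := key _ (hn n)
        rw [← mul_assoc, ← pow_succ'] at this
        rw [pow_succ' c, mul_assoc]
        exact this.trans (by gcongr)
    have h5 : Tendsto (fun n : ℕ => c ^ n * w T) atTop (nhds 0) := by
      simpa using (tendsto_pow_atTop_nhds_zero_of_lt_one hc0.le hc2).mul_const (w T)
    have h6 : m ≤ 0 := ge_of_tendsto' h5 fun n =>
      (hmw _ (((le_max_right _ _).trans (le_max_right _ _)).trans (hn n))).trans (key2 n)
    linarith
  obtain ⟨M, hM⟩ := hM X₀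
  have hC1 : 0 ≤ |M| / m := by positivity
  have hC2 : 0 ≤ Real.exp (1/2) := by positivity
  have hC3 : 0 ≤ Real.exp (1/2) * (|b| ^ ρ * |b| ^ (1/2:ℝ)) := by positivity
  refine ⟨max X₀ X₁, by positivity, |M| / m + Real.exp (1/2) + Real.exp (1/2) * (|b| ^ ρ * |b| ^ (1/2:ℝ)),
    by positivity, fun t ht => ?_⟩
  have ht1 := (le_max_left _ _).trans ht
  have ht2 := (le_max_right _ _).trans ht
  have hmt := hmw t ht2
  have hwt : 0 < w t := hm.trans_le hmt
  have ht0 : 0 < t := hX₀.trans_le ht1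
  refine ⟨hwt, fun r hr hrb => ?_⟩
  have hA : 0 ≤ (t / r) ^ (1/2:ℝ) := by positivity
  set A := (t / r) ^ (1/2:ℝ) with hAdef
  set C1 := |M| / m
  set C2 := Real.exp (1/2)
  set C3 := C2 * (|b| ^ ρ * |b| ^ (1/2:ℝ))
  have e1 : 0 ≤ C1 * w t := by positivity
  have e2 : 0 ≤ C2 * w t := by positivity
  have e3 : 0 ≤ C3 * w t := by positivity
  have e1' := mul_nonneg e1 hA
  have e2' := mul_nonneg e2 hA
  have e3' := mul_nonneg e3 hA
  rcases le_total r X₀ with h | h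
  · have : w r ≤ C1 * w t := by
      calc w r ≤ |M| := (hM r hr h).trans (le_abs_self _)
        _ = C1 * m := by simp only [C1]; field_simp
        _ ≤ _ := by gcongr
    linarith
  rcases le_total r t with h' | h'
  · have h1 := ((hP r h).2 t h').2
    have : w r ≤ C2 * w t * A := by
      rw [hw r hr, hw t ht0]
      have : r ^ ρ ≤ t ^ ρ := Real.rpow_le_rpow hr.le h' hρ
      calc r ^ ρ * L r ≤ t ^ ρ * (C2 * A * L t) := by
            have := (hP r h).1
            gcongr
        _ = _ := by ring
    linarith
  · have h1 := ((hP t ht1).2 r h').1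
    have hrt : r / t ≤ |b| := by
      rw [div_le_iff₀ ht0]
      exact hrb.trans (by gcongr; exact le_abs_self b)
    have : w r ≤ C3 * w t := by
      have hLt := (hP t ht1).1
      rw [hw r hr, hw t ht0]
      have e : r ^ ρ = (r/t) ^ ρ * t ^ ρ := by rw [← Real.mul_rpow (by positivity) ht0.le]; congr 1; field_simp
      calc r ^ ρ * L r ≤ r ^ ρ * (C2 * (r/t) ^ (1/2:ℝ) * L t) := by gcongr
        _ = (C2 * ((r/t)^ρ * (r/t) ^ (1/2:ℝ))) * (t ^ ρ * L t) := by rw [e]; ring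
        _ ≤ _ := by simp only [C3]; gcongr
    linarith

lemma dbi_repr (d : ℕ) (K : EuclideanSpace ℝ (Fin d) → ℝ)
    (hKloc : LocallyIntegrable K volume) (p q : ℝ) :
    (∫ x in Metric.closedBall (0 : EuclideanSpace ℝ (Fin d)) p,
          ∫ y in Metric.closedBall (0 : EuclideanSpace ℝ (Fin d)) q, K (x - y)) =
    ∫ z in Metric.closedBall (0 : EuclideanSpace ℝ (Fin d)) (p + q),
      K z * volume.real (Metric.closedBall (0 : EuclideanSpace ℝ (Fin d)) p ∩ Metric.closedBall z q) := by
  have hfin : IsFiniteMeasure (volume.restrict (Metric.closedBall (0 : EuclideanSpace ℝ (Fin d)) p)) :=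
    ⟨by rw [Measure.restrict_apply_univ]; exact measure_closedBall_lt_top⟩
  have hS : MeasurableSet {y : EuclideanSpace ℝ (Fin d) × EuclideanSpace ℝ (Fin d) | dist y.1 y.2 ≤ q} :=
    (isClosed_le continuous_dist continuous_const).measurableSet
  have hK : IntegrableOn K (Metric.closedBall (0 : EuclideanSpace ℝ (Fin d)) (p + q)) :=
    hKloc.integrableOn_isCompact (isCompact_closedBall _ _)
  have key := (dbi_swap (volume.restrict (Metric.closedBall (0 : EuclideanSpace ℝ (Fin d)) p)) _ K hK _ hS).2
  have e : ∀ z : EuclideanSpace ℝ (Fin d), (volume.restrict (Metric.closedBall (0 : EuclideanSpace ℝ (Fin d)) p)).real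
      {x | (x, z) ∈ {y : EuclideanSpace ℝ (Fin d) × EuclideanSpace ℝ (Fin d) | dist y.1 y.2 ≤ q}} =
      volume.real (Metric.closedBall (0 : EuclideanSpace ℝ (Fin d)) p ∩ Metric.closedBall z q) := by
    intro z
    rw [measureReal_restrict_apply' measurableSet_closedBall, Set.inter_comm]
    rfl
  simp_rw [e] at key
  rw [← key]
  refine setIntegral_congr_fun measurableSet_closedBall fun x hx => ?_
  have hx' : ‖x‖ ≤ p := by simpa using hx
  have hset : {z | (x, z) ∈ {y : EuclideanSpace ℝ (Fin d) × EuclideanSpace ℝ (Fin d) | dist y.1 y.2 ≤ q}} =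
      Metric.closedBall x q := by
    ext z
    simp [dist_comm]
  have hsub : Metric.closedBall x q ⊆ Metric.closedBall 0 (p + q) :=
    Metric.closedBall_subset_closedBall' (by rw [dist_zero_right]; linarith)
  simp only [hset]
  rw [Measure.restrict_restrict measurableSet_closedBall, Set.inter_eq_left.2 hsub,
    ← integral_indicator measurableSet_closedBall, ← integral_indicator measurableSet_closedBall,
    ← integral_sub_left_eq_self _ volume x]
  congr 1 with y
  simp only [Set.indicator, Metric.mem_closedBall, dist_eq_norm]
  rw [sub_zero, sub_sub_cancel, norm_sub_rev]

lemma dbi_layer (d : ℕ) (D : Set (EuclideanSpace ℝ (Fin d))) (K f : EuclideanSpace ℝ (Fin d) → ℝ)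
    (hK : IntegrableOn K D) (hf : Measurable f) (hf0 : ∀ z, 0 ≤ f z) (hf1 : ∀ z, f z ≤ 1) :
    IntegrableOn (fun θ : ℝ => ∫ z in {z | θ < f z}, K z ∂(volume.restrict D)) (Set.Ioo 0 1) ∧
    ∫ θ in Set.Ioo (0:ℝ) 1, ∫ z in {z | θ < f z}, K z ∂(volume.restrict D) = ∫ z in D, K z * f z := by
  have hS : MeasurableSet {y : ℝ × EuclideanSpace ℝ (Fin d) | y.1 < f y.2} :=
    measurableSet_lt measurable_fst (hf.comp measurable_snd)
  have hfin : IsFiniteMeasure (volume.restrict (Set.Ioo (0:ℝ) 1)) :=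
    ⟨by rw [Measure.restrict_apply_univ]; exact measure_Ioo_lt_top⟩
  have key := dbi_swap (volume.restrict (Set.Ioo (0:ℝ) 1)) _ K hK _ hS
  refine ⟨key.1, key.2.trans ?_⟩
  congr 1 with z
  congr 1
  rw [measureReal_restrict_apply' measurableSet_Ioo]
  have : {x | (x, z) ∈ {y : ℝ × EuclideanSpace ℝ (Fin d) | y.1 < f y.2}} ∩ Set.Ioo 0 1 = Set.Ioo 0 (f z) := by
    ext x
    simp only [Set.mem_inter_iff, Set.mem_ofPred_eq, Set.mem_Ioo]
    exact ⟨fun h => ⟨h.2.1, h.1⟩, fun h => ⟨h.2, h.1, h.2.trans_le (hf1 z)⟩⟩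
  rw [this, Real.volume_real_Ioo_of_le (hf0 z), sub_zero]

lemma dbi_phi (c : ℝ) (hc : 0 < c) :
    IntegrableOn (fun θ : ℝ => 1 + (1 / (c * (1 - θ))) ^ (1/2:ℝ)) (Set.Ioo 0 1) := by
  have h1 : IntervalIntegrable (fun x : ℝ => x ^ (-(1/2) : ℝ)) volume 0 1 :=
    intervalIntegral.intervalIntegrable_rpow' (by norm_num)
  have h2 := (h1.comp_sub_left 1).symm
  simp only [sub_self, sub_zero] at h2
  rw [intervalIntegrable_iff_integrableOn_Ioo_of_le zero_le_one] at h2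
  refine IntegrableOn.congr_fun (f := fun θ : ℝ => 1 + (1 / c) ^ (1/2:ℝ) * (1 - θ) ^ (-(1/2) : ℝ)) ?_ ?_ measurableSet_Ioo
  · exact Integrable.add (integrableOn_const (by simp)) (h2.const_mul _)
  · intro θ hθ
    have : 0 < 1 - θ := by linarith [hθ.2]
    simp only
    rw [Real.rpow_neg this.le, ← Real.inv_rpow this.le, ← Real.mul_rpow (by positivity) (by positivity)]
    congr 2
    field_simp

lemma dbi_f_lower (d : ℕ) (hd : 1 ≤ d) (p q : ℝ) (hp : 0 < p) (hpq : p ≤ q) (θ : ℝ) (h0 : 0 < θ) (h1 : θ < 1)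
    (z : EuclideanSpace ℝ (Fin d)) (hz : ‖z‖ < q / (2 * d) * (1 - θ)) :
    θ * volume.real (Metric.closedBall (0 : EuclideanSpace ℝ (Fin d)) p) <
      volume.real (Metric.closedBall (0 : EuclideanSpace ℝ (Fin d)) p ∩ Metric.closedBall z q) := by
  have hd' : (1:ℝ) ≤ d := by exact_mod_cast hd
  have hq : 0 < q := hp.trans_le hpq
  have hB : 0 < volume.real (Metric.ball (0 : EuclideanSpace ℝ (Fin d)) 1) :=
    ENNReal.toReal_pos (Metric.measure_ball_pos _ _ one_pos).ne' measure_ball_lt_top.ne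
  have hV := Measure.addHaar_real_closedBall (volume : Measure (EuclideanSpace ℝ (Fin d))) 0 hp.le
  rw [finrank_euclideanSpace_fin] at hV
  have hV0 : 0 < volume.real (Metric.closedBall (0 : EuclideanSpace ℝ (Fin d)) p) := by rw [hV]; positivity
  rcases le_total p (q / 2) with h | h
  · have hz' : ‖z‖ ≤ q / 2 := by
      refine hz.le.trans ?_
      calc q / (2 * d) * (1 - θ) ≤ q / (2 * 1) * 1 := by gcongr; linarith
        _ = q / 2 := by ring
    have : Metric.closedBall (0 : EuclideanSpace ℝ (Fin d)) p ⊆ Metric.closedBall z q :=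
      Metric.closedBall_subset_closedBall' (by rw [dist_zero_left]; linarith)
    rw [Set.inter_eq_left.2 this]
    nlinarith
  · have hz' : ‖z‖ * d < p * (1 - θ) := by
      have : q / (2 * d) * (1 - θ) * d = q / 2 * (1 - θ) := by field_simp
      have h3 : ‖z‖ * d < q / (2 * d) * (1 - θ) * d := by gcongr
      rw [this] at h3
      exact h3.trans_le (by gcongr)
    have hzp : ‖z‖ ≤ p := by nlinarith [norm_nonneg z]
    have hsub : Metric.closedBall (0 : EuclideanSpace ℝ (Fin d)) (p - ‖z‖) ⊆
        Metric.closedBall (0 : EuclideanSpace ℝ (Fin d)) p ∩ Metric.closedBall z q :=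
      Set.subset_inter (Metric.closedBall_subset_closedBall (by linarith [norm_nonneg z]))
        (Metric.closedBall_subset_closedBall' (by rw [dist_zero_left]; linarith))
    have hfin : volume (Metric.closedBall (0 : EuclideanSpace ℝ (Fin d)) p ∩ Metric.closedBall z q) ≠ ⊤ :=
      measure_ne_top_of_subset Set.inter_subset_left measure_closedBall_lt_top.ne
    refine lt_of_lt_of_le ?_ (measureReal_mono hsub hfin)
    rw [hV, Measure.addHaar_real_closedBall _ _ (sub_nonneg.2 hzp), finrank_euclideanSpace_fin, ← mul_assoc]
    gcongr
    have hb := one_add_mul_le_pow (a := -(‖z‖ / p)) (by have : ‖z‖ / p ≤ 1 := by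
                                                         rwa [div_le_one hp]
                                                        linarith) d
    have e : p - ‖z‖ = p * (1 + -(‖z‖ / p)) := by field_simp; ring
    rw [e, mul_pow, mul_comm]
    gcongr
    refine lt_of_lt_of_le ?_ hb
    have : ‖z‖ * d / p < 1 - θ := by rw [div_lt_iff₀ hp]; linarith
    have e2 : (d:ℝ) * -(‖z‖ / p) = -(‖z‖ * d / p) := by ring
    rw [e2]; linarith

/-- Double-ball integral bound for regularly varying mass functions (Lemma 4.3). -/
theorem double_ball_integral_bound
    (d : ℕ) (hd : 1 ≤ d)
    (K : EuclideanSpace ℝ (Fin d) → ℝ)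
    (hKloc : LocallyIntegrable K volume)
    (w : ℝ → ℝ)
    (hw : ∀ t : ℝ, 0 < t → w t = ∫ z in Metric.closedBall (0 : EuclideanSpace ℝ (Fin d)) t, K z)
    (hwrv : RegularlyVarying w)
    (hwlim : Tendsto w atTop atTop ∨ ∃ l : ℝ, 0 < l ∧ Tendsto w atTop (nhds l))
    (a : ℝ) (ha : 0 < a) :
    ∀ δ : ℝ, 0 < δ → ∃ X : ℝ, 0 < X ∧ ∃ C : ℝ,
      ∀ t₁ t₂ : ℝ, X ≤ t₁ → t₁ ≤ t₂ →
        (∫ x in Metric.closedBall (0 : EuclideanSpace ℝ (Fin d)) (a * t₁),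
          ∫ y in Metric.closedBall (0 : EuclideanSpace ℝ (Fin d)) (a * t₂), K (x - y))
        ≤ C * t₁ ^ (d : ℕ) * w t₂ := by
  intro _ _
  obtain ⟨ρ, L, hL, hwL⟩ := hwrv
  have hKint : ∀ X, IntegrableOn K (Metric.closedBall (0 : EuclideanSpace ℝ (Fin d)) X) := fun X =>
    hKloc.integrableOn_isCompact (isCompact_closedBall _ _)
  have hM : ∀ X, ∃ M, ∀ r, 0 < r → r ≤ X → w r ≤ M := by
    intro X
    refine ⟨∫ z in Metric.closedBall (0 : EuclideanSpace ℝ (Fin d)) X, ‖K z‖, fun r hr hrX => ?_⟩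
    rw [hw r hr]
    refine (le_abs_self _).trans ((norm_integral_le_integral_norm K).trans ?_)
    exact setIntegral_mono_set (hKint X).norm (Eventually.of_forall fun z => norm_nonneg _)
      (Metric.closedBall_subset_closedBall hrX).eventuallyLE
  obtain ⟨X, hX, C, hC, hmain⟩ := dbi_w w L ρ (dbi_potter L hL) (hL.2.2 2 two_pos) hwL hwlim hM (2 * a)
  have hd' : (1:ℝ) ≤ d := by exact_mod_cast hd
  set c := a / (2 * d) with hc
  have hc0 : 0 < c := by positivity
  set J := ∫ θ in Set.Ioo (0:ℝ) 1, (1 + (1 / (c * (1 - θ))) ^ (1/2:ℝ)) with hJ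
  set v := volume.real (Metric.ball (0 : EuclideanSpace ℝ (Fin d)) 1) with hv
  have hv0 : 0 < v :=
    ENNReal.toReal_pos (Metric.measure_ball_pos _ _ one_pos).ne' measure_ball_lt_top.ne
  refine ⟨X, hX, a ^ d * v * (C * J), fun t₁ t₂ h1 h12 => ?_⟩
  have ht1 : 0 < t₁ := hX.trans_le h1
  have ht2 : 0 < t₂ := ht1.trans_le h12
  obtain ⟨hw2, hmain⟩ := hmain t₂ (h1.trans h12)
  set p := a * t₁ with hp
  set q := a * t₂ with hq
  have hp0 : 0 < p := by positivity
  have hpq : p ≤ q := by simp only [hp, hq]; gcongr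
  set V := volume.real (Metric.closedBall (0 : EuclideanSpace ℝ (Fin d)) p) with hV
  have hVe : V = p ^ d * v := by
    rw [hV, Measure.addHaar_real_closedBall _ _ hp0.le, finrank_euclideanSpace_fin]
  have hV0 : 0 < V := by rw [hVe]; positivity
  set g : EuclideanSpace ℝ (Fin d) → ℝ := fun z =>
    volume.real (Metric.closedBall (0 : EuclideanSpace ℝ (Fin d)) p ∩ Metric.closedBall z q) with hg
  have hfin : ∀ z, volume (Metric.closedBall (0 : EuclideanSpace ℝ (Fin d)) p ∩ Metric.closedBall z q) ≠ ⊤ :=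
    fun z => measure_ne_top_of_subset Set.inter_subset_left measure_closedBall_lt_top.ne
  have hgm : Measurable g := by
    have hS1 : IsClosed {y : EuclideanSpace ℝ (Fin d) × EuclideanSpace ℝ (Fin d) | dist y.2 0 ≤ p} :=
      isClosed_le (by fun_prop) continuous_const
    have hS2 : IsClosed {y : EuclideanSpace ℝ (Fin d) × EuclideanSpace ℝ (Fin d) | dist y.2 y.1 ≤ q} :=
      isClosed_le (by fun_prop) continuous_const
    have hS := (hS1.inter hS2).measurableSet
    exact (measurable_measure_prodMk_left (ν := volume) hS).ennreal_toReal
  have hganti : ∀ z z', ‖z'‖ ≤ ‖z‖ → g z ≤ g z' := fun z z' h =>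
    ENNReal.toReal_mono (hfin z') (dbi_anti d p q z z' h)
  have hg0 : ∀ z, 0 ≤ g z := fun z => measureReal_nonneg
  have hgV : ∀ z, g z ≤ V := fun z =>
    measureReal_mono Set.inter_subset_left measure_closedBall_lt_top.ne
  obtain ⟨hI, hE⟩ := dbi_layer d (Metric.closedBall 0 (p + q)) K (fun z => g z / V) (hKint _)
    (hgm.div_const V) (fun z => div_nonneg (hg0 z) hV0.le) (fun z => (div_le_one hV0).2 (hgV z))
  have hIV : (∫ x in Metric.closedBall (0 : EuclideanSpace ℝ (Fin d)) p,
          ∫ y in Metric.closedBall (0 : EuclideanSpace ℝ (Fin d)) q, K (x - y)) =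
      V * ∫ θ in Set.Ioo (0:ℝ) 1, ∫ z in {z | θ < g z / V}, K z
        ∂(volume.restrict (Metric.closedBall 0 (p + q))) := by
    rw [dbi_repr d K hKloc, hE, ← integral_const_mul]
    congr 1 with z
    simp only [hg]
    field_simp
  have hpt : ∀ θ ∈ Set.Ioo (0:ℝ) 1, ∫ z in {z | θ < g z / V}, K z
        ∂(volume.restrict (Metric.closedBall 0 (p + q))) ≤
        C * w t₂ * (1 + (1 / (c * (1 - θ))) ^ (1/2:ℝ)) := by
    intro θ hθ
    have hθ' : 0 < 1 - θ := by linarith [hθ.2]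
    have hsubD : {z | θ < g z / V} ⊆ Metric.closedBall (0 : EuclideanSpace ℝ (Fin d)) (p + q) := by
      intro z hz
      by_contra hcon
      have hcon' : p + q < ‖z‖ := by simpa using hcon
      have : Metric.closedBall (0 : EuclideanSpace ℝ (Fin d)) p ∩ Metric.closedBall z q = ∅ := by
        rw [← Set.disjoint_iff_inter_eq_empty]
        exact Metric.closedBall_disjoint_closedBall (by rwa [dist_zero_left])
      have hgz : g z = 0 := by simp only [hg, this]; simp
      have hz' : θ < g z / V := hz
      rw [hgz, zero_div] at hz'
      exact absurd hθ.1 (not_lt.2 hz'.le)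
    obtain ⟨R, hR1, hR2, hRS⟩ := dbi_set d hd {z | θ < g z / V}
      (fun z hz z' h => lt_of_lt_of_le hz (div_le_div_of_nonneg_right (hganti z z' h) hV0.le))
      (c * (1 - θ) * t₂) (p + q) (by positivity)
      (fun z hz => by
        have hz' : ‖z‖ < c * (1 - θ) * t₂ := by simpa using hz
        have := dbi_f_lower d hd p q hp0 hpq θ hθ.1 hθ.2 z (by
          convert hz' using 1
          simp only [hq, hc]; ring)
        exact (lt_div_iff₀ hV0).2 this) hsubD
    have hR0 : 0 < R := lt_of_lt_of_le (by positivity) hR1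
    have e : ∫ z in {z | θ < g z / V}, K z ∂(volume.restrict (Metric.closedBall 0 (p + q))) = w R := by
      rw [hw R hR0, Measure.restrict_restrict (measurableSet_lt measurable_const (hgm.div_const V)),
        Set.inter_eq_left.2 hsubD]
      exact setIntegral_congr_set hRS
    rw [e]
    refine (hmain R hR0 (hR2.trans (by simp only [hp, hq]; nlinarith))).trans ?_
    gcongr C * w t₂ * (1 + ?_ ^ (1/2:ℝ))
    rw [div_le_div_iff₀ hR0 (by positivity)]
    linarith
  have hle : ∫ θ in Set.Ioo (0:ℝ) 1, ∫ z in {z | θ < g z / V}, K z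
        ∂(volume.restrict (Metric.closedBall 0 (p + q))) ≤ C * w t₂ * J := by
    rw [hJ, ← integral_const_mul]
    exact setIntegral_mono_on hI ((dbi_phi c hc0).const_mul _) measurableSet_Ioo hpt
  rw [hIV]
  calc _ ≤ V * (C * w t₂ * J) := by gcongr
    _ = _ := by rw [hVe, hp, mul_pow]; ring
end

section
/- Polynomial decay of normalized contractions (Lemma 4.4). Let d ≥ 1, let 𝒞 : ℝ^d → ℝ be measurable with |𝒞| ≤ 1 and |𝒞(x)| ≤ C₁|x|^{−δ} for all x ≠ 0, for some constants C₁, δ > 0, and let D ⊂ ℝ^d be compact with positive volume. Let (a_q)_{q≥0} be real coefficients with ∑_q a_q² q! < ∞, a_q = 0 for 1 ≤ q < R and a_R ≠ 0, and set σ_t² := ∑_{q=R}^∞ a_q² q! ∫_{(tD)²} 𝒞(x−y)^q dx dy. Assume there exist t₀ > 0 and c₀ > 0 with σ_t² ≥ c₀ t^d for all t ≥ t₀ (as holds under Conditions (A) and (C) of the paper by Lemma 4.2). Define h_t(k₁,k₂) := ∫_{(tD)⁴} 𝒞(x−y)^{k₁}𝒞(z−w)^{k₁}𝒞(x−z)^{k₂}𝒞(y−w)^{k₂}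 dx dy dz dw and ξ_m(t) := sup{√(h_t(k₁,k₂))/σ_t² : k₁, k₂ ≥ 1, k₁ + k₂ ≥ m}. Then for every integer m > d/δ there exists a finite constant c such that ξ_m(t)² ≤ c · t^{−a} for all sufficiently large t, where a = min{δm − d, d, δ/2} > 0. -/
open MeasureTheory
open scoped Pointwise

section helpers
open ENNReal

variable {E : Type*} [NormedAddCommGroup E] [NormedSpace ℝ E] [FiniteDimensional ℝ E]
  [MeasurableSpace E] [BorelSpace E] (μ : Measure E) [μ.IsAddHaarMeasure]

theorem ball_aux [Nontrivial E] (α r : ℝ) (hα : α < Module.finrank ℝ E) (hr : 0 < r) :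
    ∫⁻ x in Metric.ball (0:E) r, ENNReal.ofReal (‖x‖ ^ (-α)) ∂μ =
      ENNReal.ofReal (Module.finrank ℝ E * μ.real (Metric.ball 0 1) *
        (r ^ ((Module.finrank ℝ E : ℝ) - α) / ((Module.finrank ℝ E : ℝ) - α))) := by
  set n := Module.finrank ℝ E with hn
  have hn1 : 1 ≤ n := Module.finrank_pos
  have hpow : ∀ y ∈ Set.Ioo (0:ℝ) r, y ^ (n - 1) • y ^ (-α) = y ^ ((n:ℝ) - 1 - α) := by
    intro y hy
    rw [smul_eq_mul, ← Real.rpow_natCast, ← Real.rpow_add hy.1]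
    congr 1
    push_cast [hn1]
    ring
  have hexp : -1 < (n:ℝ) - 1 - α := by linarith
  have hint : IntegrableOn (fun x : E => ‖x‖ ^ (-α)) (Metric.ball 0 r) μ := by
    rw [integrableOn_fun_norm_addHaar μ (f := fun y => y ^ (-α)),
      integrableOn_congr_fun hpow measurableSet_Ioo,
      ← intervalIntegrable_iff_integrableOn_Ioo_of_le hr.le]
    exact intervalIntegral.intervalIntegrable_rpow' hexp
  rw [← ofReal_integral_eq_lintegral_ofReal hint (ae_of_all _ fun x => by positivity)]
  congr 1
  have h1 : ∫ x in Metric.ball (0:E) r, ‖x‖ ^ (-α) ∂μ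
      = ∫ x, (Set.Iio r).indicator (fun y : ℝ => y ^ (-α)) ‖x‖ ∂μ := by
    rw [← integral_indicator measurableSet_ball]
    apply integral_congr_ae
    filter_upwards with x
    simp [Set.indicator]
  rw [h1, integral_fun_norm_addHaar μ]
  have h2 : ∫ y in Set.Ioi (0:ℝ), y ^ (n - 1) • (Set.Iio r).indicator (fun y : ℝ => y ^ (-α)) y
      = ∫ y in Set.Ioo (0:ℝ) r, y ^ ((n:ℝ) - 1 - α) := by
    rw [← integral_indicator measurableSet_Ioi, ← integral_indicator measurableSet_Ioo]
    apply integral_congr_ae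
    filter_upwards with y
    by_cases h0 : 0 < y <;> by_cases h3 : y < r <;> simp [Set.indicator, h0, h3]
    simpa using hpow y ⟨h0, h3⟩
  rw [← hn, h2, ← integral_Ioc_eq_integral_Ioo, ← intervalIntegral.integral_of_le hr.le,
    integral_rpow (Or.inl hexp)]
  have : (n:ℝ) - 1 - α + 1 = n - α := by ring
  rw [this, Real.zero_rpow (by linarith)]
  simp
  ring

theorem core_aux (C : E → ℝ) (S : Set E) (hS : MeasurableSet S) (p q P : E → ℝ≥0∞)
    (hp : Measurable p) (hq : Measurable q) (hP : Measurable P) (k₁ k₂ : ℕ)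
    (h1 : ∀ x, ‖C x‖ₑ ^ k₁ ≤ p x) (h2 : ∀ x, ‖C x‖ₑ ^ k₂ ≤ q x)
    (hpq : ∀ x y, p x * q y ≤ P x + P y) (A B : ℝ≥0∞)
    (hA : ∀ x ∈ S, ∫⁻ y in S, p (x - y) ∂μ ≤ A)
    (hB : ∀ x ∈ S, ∫⁻ y in S, q (x - y) ∂μ ≤ B) :
    ‖∫ x in S, ∫ y in S, ∫ z in S, ∫ v in S,
        C (x - y) ^ k₁ * C (z - v) ^ k₁ * C (x - z) ^ k₂ * C (y - v) ^ k₂ ∂μ ∂μ ∂μ ∂μ‖ₑ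
      ≤ (2 * ∫⁻ x, P x ∂μ) * B * A * μ S := by
  set K := ∫⁻ x, P x ∂μ
  have i4 : ∀ x y z, ‖∫ v in S, C (x - y) ^ k₁ * C (z - v) ^ k₁ * C (x - z) ^ k₂ *
      C (y - v) ^ k₂ ∂μ‖ₑ ≤ p (x - y) * (q (x - z) * (2 * K)) := by
    intro x y z
    calc _ ≤ ∫⁻ v in S, (p (x - y) * q (x - z)) * (P (z - v) + P (y - v)) ∂μ := by
            refine (enorm_integral_le_lintegral_enorm _).trans (lintegral_mono fun v => ?_)
            simp only [enorm_mul, enorm_pow]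
            calc _ ≤ p (x - y) * p (z - v) * q (x - z) * q (y - v) := by
                    gcongr <;> first | exact h1 _ | exact h2 _
              _ = (p (x - y) * q (x - z)) * (p (z - v) * q (y - v)) := by ring
              _ ≤ _ := by gcongr; exact hpq _ _
      _ ≤ ∫⁻ v, (p (x - y) * q (x - z)) * (P (z - v) + P (y - v)) ∂μ :=
            setLIntegral_le_lintegral _ _
      _ = (p (x - y) * q (x - z)) * (K + K) := by
            rw [lintegral_const_mul _ (by fun_prop), lintegral_add_left (by fun_prop),
              lintegral_sub_left_eq_self P z, lintegral_sub_left_eq_self P y]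
      _ = _ := by ring
  have i3 : ∀ x ∈ S, ∀ y, ‖∫ z in S, ∫ v in S, C (x - y) ^ k₁ * C (z - v) ^ k₁ * C (x - z) ^ k₂ *
      C (y - v) ^ k₂ ∂μ ∂μ‖ₑ ≤ p (x - y) * (B * (2 * K)) := by
    intro x hx y
    refine (enorm_integral_le_lintegral_enorm _).trans ((lintegral_mono fun z => i4 x y z).trans ?_)
    rw [lintegral_const_mul _ (by fun_prop), lintegral_mul_const _ (by fun_prop)]
    gcongr
    exact hB x hx
  have i2 : ∀ x ∈ S, ‖∫ y in S, ∫ z in S, ∫ v in S, C (x - y) ^ k₁ * C (z - v) ^ k₁ *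
      C (x - z) ^ k₂ * C (y - v) ^ k₂ ∂μ ∂μ ∂μ‖ₑ ≤ A * (B * (2 * K)) := by
    intro x hx
    refine (enorm_integral_le_lintegral_enorm _).trans
      ((lintegral_mono fun y => i3 x hx y).trans ?_)
    rw [lintegral_mul_const _ (by fun_prop)]
    gcongr
    exact hA x hx
  refine (enorm_integral_le_lintegral_enorm _).trans ((setLIntegral_mono' hS i2).trans ?_)
  rw [setLIntegral_const]
  apply le_of_eq; ring

theorem pq_aux (c e : ℝ≥0∞) (s t : ℝ) (hs : 0 ≤ s) (ht : 0 ≤ t) :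
    c ^ s * e ^ t ≤ c ^ (s + t) + e ^ (s + t) := by
  rw [ENNReal.rpow_add_of_nonneg _ _ hs ht, ENNReal.rpow_add_of_nonneg _ _ hs ht]
  rcases le_total c e with h | h
  · exact le_add_left (by gcongr)
  · exact le_add_right (by gcongr)

theorem conv_aux (p : E → ℝ≥0∞) (S : Set E) (hS : MeasurableSet S) (ρ : ℝ)
    (hSb : S ⊆ Metric.ball 0 ρ) (x : E) (hx : x ∈ S) :
    ∫⁻ y in S, p (x - y) ∂μ ≤ ∫⁻ y in Metric.ball 0 (2 * ρ), p y ∂μ := by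
  calc _ ≤ ∫⁻ y in S, (Metric.ball 0 (2 * ρ)).indicator p (x - y) ∂μ := by
        refine setLIntegral_mono' hS fun y hy => ?_
        rw [Set.indicator_of_mem]
        have h1 := hSb hx
        have h2 := hSb hy
        simp only [mem_ball_zero_iff] at *
        linarith [norm_sub_le x y]
    _ ≤ ∫⁻ y, (Metric.ball 0 (2 * ρ)).indicator p (x - y) ∂μ := setLIntegral_le_lintegral _ _
    _ = _ := by rw [lintegral_sub_left_eq_self (μ := μ) _ x, lintegral_indicator measurableSet_ball]

theorem pow_aux (C : E → ℝ) (C₁ δ : ℝ) (hδ : 0 < δ) (hC₁ : 0 < C₁)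
    (hdecay : ∀ x : E, x ≠ 0 → |C x| ≤ C₁ * ‖x‖ ^ (-δ)) (α : ℝ) (hα : 0 ≤ α) (x : E) (hx : x ≠ 0) :
    ‖C x‖ₑ ^ (α / δ) ≤ ENNReal.ofReal (C₁ ^ (α / δ)) * ENNReal.ofReal (‖x‖ ^ (-α)) := by
  have hx' : 0 < ‖x‖ := norm_pos_iff.2 hx
  rw [Real.enorm_eq_ofReal_abs, ENNReal.ofReal_rpow_of_nonneg (abs_nonneg _) (by positivity),
    ← ENNReal.ofReal_mul (by positivity)]
  apply ENNReal.ofReal_le_ofReal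
  calc |C x| ^ (α / δ) ≤ (C₁ * ‖x‖ ^ (-δ)) ^ (α / δ) := by gcongr; exact hdecay x hx
    _ = _ := by
      rw [Real.mul_rpow hC₁.le (by positivity), ← Real.rpow_mul hx'.le]
      congr 2
      field_simp

theorem J_aux [Nontrivial E] (C : E → ℝ) (C₁ δ : ℝ) (hδ : 0 < δ) (hC₁ : 0 < C₁)
    (hdecay : ∀ x : E, x ≠ 0 → |C x| ≤ C₁ * ‖x‖ ^ (-δ)) (α r : ℝ) (hα : 0 ≤ α)
    (hα' : α < Module.finrank ℝ E) (hr : 0 < r) :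
    ∫⁻ x in Metric.ball (0:E) r, ‖C x‖ₑ ^ (α / δ) ∂μ ≤
      ENNReal.ofReal (C₁ ^ (α / δ) * (Module.finrank ℝ E * μ.real (Metric.ball 0 1) *
        (r ^ ((Module.finrank ℝ E : ℝ) - α) / ((Module.finrank ℝ E : ℝ) - α)))) := by
  rw [ENNReal.ofReal_mul (by positivity), ← ball_aux μ α r hα' hr,
    ← lintegral_const_mul _ (by fun_prop)]
  refine lintegral_mono_ae ?_
  have : ∀ᵐ x ∂(μ.restrict (Metric.ball (0:E) r)), x ≠ 0 :=
    ae_restrict_of_ae (by simp [ae_iff])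
  filter_upwards [this] with x hx
  exact pow_aux C C₁ δ hδ hC₁ hdecay α hα x hx

theorem K_aux (C : E → ℝ) (C₁ δ : ℝ) (hδ : 0 < δ) (hC₁ : 0 < C₁) (hCbdd : ∀ x, |C x| ≤ 1)
    (hdecay : ∀ x : E, x ≠ 0 → |C x| ≤ C₁ * ‖x‖ ^ (-δ)) (e : ℝ) (he : Module.finrank ℝ E < e) :
    ∫⁻ x, ‖C x‖ₑ ^ (e / δ) ∂μ < ∞ := by
  have he0 : 0 < e := lt_of_le_of_lt (Nat.cast_nonneg _) he
  set M := max 1 (C₁ ^ (e / δ)) * 2 ^ e with hM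
  have key : ∀ x, ‖C x‖ₑ ^ (e / δ) ≤ ENNReal.ofReal M * ENNReal.ofReal ((1 + ‖x‖) ^ (-e)) := by
    intro x
    rw [hM, ← ENNReal.ofReal_mul (by positivity), mul_assoc]
    have h2 : (2:ℝ) ^ e * (1 + ‖x‖) ^ (-e) = ((1 + ‖x‖) / 2) ^ (-e) := by
      rw [Real.div_rpow (by positivity) (by norm_num), Real.rpow_neg (by norm_num : (0:ℝ) ≤ 2)]
      field_simp
    rw [h2]
    rcases le_total ‖x‖ 1 with h | h
    · calc ‖C x‖ₑ ^ (e / δ) ≤ 1 := by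
            apply ENNReal.rpow_le_one _ (by positivity)
            rw [Real.enorm_eq_ofReal_abs]
            simpa using hCbdd x
        _ = ENNReal.ofReal (1 * 1) := by simp
        _ ≤ _ := by
            apply ENNReal.ofReal_le_ofReal
            gcongr
            · exact le_max_left _ _
            · exact Real.one_le_rpow_of_pos_of_le_one_of_nonpos (by positivity) (by linarith)
                (by linarith)
    · have hx : x ≠ 0 := by rintro rfl; simp at h; linarith
      refine (pow_aux C C₁ δ hδ hC₁ hdecay e he0.le x hx).trans ?_
      rw [← ENNReal.ofReal_mul (by positivity)]
      apply ENNReal.ofReal_le_ofReal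
      gcongr ?_ * ?_
      · exact le_max_right _ _
      · exact Real.rpow_le_rpow_of_nonpos (by positivity) (by linarith) (by linarith)
  refine (lintegral_mono key).trans_lt ?_
  rw [lintegral_const_mul' _ _ ofReal_ne_top]
  exact ENNReal.mul_lt_top ofReal_lt_top (finite_integral_one_add_norm he)


theorem mid_aux (C : E → ℝ) (hC : Measurable C) (hCbdd : ∀ x, |C x| ≤ 1) (δ : ℝ) (hδ : 0 < δ)
    (D : Set E) (hD : IsCompact D) (ρ : ℝ) (hDρ : D ⊆ Metric.ball 0 ρ)
    (n : ℕ) (hn : Module.finrank ℝ E = n) (a : ℝ)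
    (hK : ∫⁻ x, ‖C x‖ₑ ^ ((n + a) / δ) ∂μ < ∞)
    (t : ℝ) (ht : 1 ≤ t) (k₁ k₂ : ℕ) (α β u w G : ℝ) (hG : 0 ≤ G) (hα : 0 ≤ α) (hβ : 0 ≤ β)
    (hαk : α ≤ δ * k₁) (hβk : β ≤ δ * k₂) (hαβ : n + a ≤ α + β) (huw : u + w ≤ n - a)
    (hJ1 : ∫⁻ x in Metric.ball (0:E) (2 * (t * ρ)), ‖C x‖ₑ ^ (α / δ) ∂μ ≤ ENNReal.ofReal (G * t ^ u))
    (hJ2 : ∫⁻ x in Metric.ball (0:E) (2 * (t * ρ)), ‖C x‖ₑ ^ (β / δ) ∂μ ≤ ENNReal.ofReal (G * t ^ w)) :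
    |∫ x in t • D, ∫ y in t • D, ∫ z in t • D, ∫ v in t • D,
        C (x - y) ^ k₁ * C (z - v) ^ k₁ * C (x - z) ^ k₂ * C (y - v) ^ k₂ ∂μ ∂μ ∂μ ∂μ|
      ≤ (2 * (∫⁻ x, ‖C x‖ₑ ^ ((n + a) / δ) ∂μ).toReal * G * G * μ.real D) * t ^ (2 * n - a) := by
  have ht0 : 0 < t := by linarith
  have hS : MeasurableSet (t • D) := (hD.smul t).measurableSet
  have hSb : t • D ⊆ Metric.ball 0 (t * ρ) := by
    rintro _ ⟨x, hx, rfl⟩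
    have := hDρ hx
    simp only [mem_ball_zero_iff, norm_smul, Real.norm_eq_abs, abs_of_pos ht0] at *
    gcongr
  have hC1 : ∀ x, ‖C x‖ₑ ≤ 1 := fun x => by
    rw [Real.enorm_eq_ofReal_abs]; simpa using hCbdd x
  have hpow : ∀ (α : ℝ) (k : ℕ), α ≤ δ * k → ∀ x, ‖C x‖ₑ ^ k ≤ ‖C x‖ₑ ^ (α / δ) := by
    intro α k h x
    rw [← ENNReal.rpow_natCast]
    apply ENNReal.rpow_le_rpow_of_exponent_ge (hC1 x)
    rw [div_le_iff₀ hδ]; linarith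
  have hCm : Measurable fun x => ‖C x‖ₑ := hC.enorm
  have main := core_aux μ C (t • D) hS (fun x => ‖C x‖ₑ ^ (α / δ)) (fun x => ‖C x‖ₑ ^ (β / δ))
    (fun x => ‖C x‖ₑ ^ (α / δ + β / δ)) (by fun_prop) (by fun_prop) (by fun_prop) k₁ k₂
    (hpow α k₁ hαk) (hpow β k₂ hβk)
    (fun x y => pq_aux _ _ _ _ (by positivity) (by positivity)) _ _
    (fun x hx => (conv_aux μ (fun x => ‖C x‖ₑ ^ (α / δ)) _ hS _ hSb x hx).trans hJ1)
    (fun x hx => (conv_aux μ (fun x => ‖C x‖ₑ ^ (β / δ)) _ hS _ hSb x hx).trans hJ2)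
  have hP : ∫⁻ x, ‖C x‖ₑ ^ (α / δ + β / δ) ∂μ ≤ ∫⁻ x, ‖C x‖ₑ ^ ((n + a) / δ) ∂μ := by
    refine lintegral_mono fun x => ENNReal.rpow_le_rpow_of_exponent_ge (hC1 x) ?_
    rw [← add_div]; gcongr
  set K := ∫⁻ x, ‖C x‖ₑ ^ ((n + a) / δ) ∂μ
  have hvol : μ (t • D) = ENNReal.ofReal (t ^ n * μ.real D) := by
    rw [Measure.addHaar_smul, hn, abs_of_nonneg (by positivity), ENNReal.ofReal_mul (by positivity),
      measureReal_def, ENNReal.ofReal_toReal hD.measure_lt_top.ne]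
  have fin : (2 * ∫⁻ x, ‖C x‖ₑ ^ (α / δ + β / δ) ∂μ) * ENNReal.ofReal (G * t ^ w) *
      ENNReal.ofReal (G * t ^ u) * μ (t • D) ≤
      ENNReal.ofReal ((2 * K.toReal * G * G * μ.real D) * t ^ (2 * n - a)) := by
    calc _ ≤ (ENNReal.ofReal 2 * ENNReal.ofReal K.toReal) * ENNReal.ofReal (G * t ^ w) *
      ENNReal.ofReal (G * t ^ u) * ENNReal.ofReal (t ^ n * μ.real D) := by
          rw [hvol, ENNReal.ofReal_toReal hK.ne]
          gcongr
          simp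
      _ = ENNReal.ofReal ((2 * K.toReal) * (G * t ^ w) * (G * t ^ u) * (t ^ n * μ.real D)) := by
          rw [ENNReal.ofReal_mul (p := (2 * K.toReal) * (G * t ^ w) * (G * t ^ u)) (by positivity),
            ENNReal.ofReal_mul (p := (2 * K.toReal) * (G * t ^ w)) (by positivity),
            ENNReal.ofReal_mul (p := 2 * K.toReal) (by positivity),
            ENNReal.ofReal_mul (p := 2) (by positivity)]
      _ ≤ _ := by
          apply ENNReal.ofReal_le_ofReal
          calc _ = (2 * K.toReal * G * G * μ.real D) * (t ^ w * t ^ u * t ^ (n:ℝ)) := by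
                rw [Real.rpow_natCast]; ring
            _ = (2 * K.toReal * G * G * μ.real D) * t ^ (w + u + n) := by
                rw [Real.rpow_add ht0, Real.rpow_add ht0]
            _ ≤ _ := by
                gcongr
                linarith
  have := main.trans fin
  rw [Real.enorm_eq_ofReal_abs] at this
  exact (ENNReal.ofReal_le_ofReal_iff (by positivity)).1 this

theorem all_aux [Nontrivial E] (C : E → ℝ) (hC : Measurable C) (hCbdd : ∀ x, |C x| ≤ 1)
    (C₁ δ : ℝ) (hδ : 0 < δ) (hC₁ : 0 < C₁)
    (hdecay : ∀ x : E, x ≠ 0 → |C x| ≤ C₁ * ‖x‖ ^ (-δ))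
    (D : Set E) (hD : IsCompact D)
    (n : ℕ) (hn : Module.finrank ℝ E = n) (m : ℕ) (hm : n < δ * m) (a : ℝ)
    (ha : a = min (δ * m - n) (min (n:ℝ) (δ / 2))) :
    ∃ M : ℝ, 0 ≤ M ∧ ∀ t : ℝ, 1 ≤ t → ∀ k₁ k₂ : ℕ, 1 ≤ k₁ → 1 ≤ k₂ → m ≤ k₁ + k₂ →
      |∫ x in t • D, ∫ y in t • D, ∫ z in t • D, ∫ v in t • D,
        C (x - y) ^ k₁ * C (z - v) ^ k₁ * C (x - z) ^ k₂ * C (y - v) ^ k₂ ∂μ ∂μ ∂μ ∂μ|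
      ≤ M * t ^ (2 * n - a) := by
  have hn1 : 1 ≤ n := hn ▸ Module.finrank_pos
  have hn1' : (1:ℝ) ≤ n := by exact_mod_cast hn1
  have ha1 : a ≤ δ * m - n := ha ▸ min_le_left _ _
  have ha2 : a ≤ n := ha ▸ (min_le_right _ _).trans (min_le_left _ _)
  have ha3 : a ≤ δ / 2 := ha ▸ (min_le_right _ _).trans (min_le_right _ _)
  have ha0 : 0 < a := by
    rw [ha]; exact lt_min (by linarith) (lt_min (by linarith) (by linarith))
  obtain ⟨ρ, hρ, hDρ⟩ := hD.isBounded.subset_ball_lt 0 0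
  have hK : ∀ e : ℝ, n < e → ∫⁻ x, ‖C x‖ₑ ^ (e / δ) ∂μ < ∞ := fun e he =>
    K_aux μ C C₁ δ hδ hC₁ hCbdd hdecay e (by rw [hn]; exact he)
  have hk : ∀ k : ℕ, 1 ≤ k → δ ≤ δ * k := fun k h =>
    le_mul_of_one_le_right hδ.le (by exact_mod_cast h)
  rcases le_or_gt (n:ℝ) (δ / 2) with hc | hc
  · -- large decay exponent
    have hK1 := hK δ (by linarith)
    set G := (∫⁻ x, ‖C x‖ₑ ^ (δ / δ) ∂μ).toReal with hG
    refine ⟨2 * (∫⁻ x, ‖C x‖ₑ ^ ((n + a) / δ) ∂μ).toReal * G * G * μ.real D, by positivity, ?_⟩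
    intro t ht k₁ k₂ h1 h2 h3
    have hJ : ∫⁻ x in Metric.ball (0:E) (2 * (t * ρ)), ‖C x‖ₑ ^ (δ / δ) ∂μ
        ≤ ENNReal.ofReal (G * t ^ (0:ℝ)) := by
      rw [Real.rpow_zero, mul_one, hG, ENNReal.ofReal_toReal hK1.ne]
      exact setLIntegral_le_lintegral _ _
    exact mid_aux μ C hC hCbdd δ hδ D hD ρ hDρ n hn a (hK _ (by linarith)) t ht k₁ k₂ δ δ 0 0 G
      (by positivity) hδ.le hδ.le (hk _ h1) (hk _ h2) (by linarith) (by linarith) hJ hJ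
  · have han : a < n := by linarith
    set η := min (δ / 2) ((n - a) / 2) with hη
    have hη0 : 0 < η := lt_min (by linarith) (by linarith)
    have hη1 : η ≤ δ / 2 := min_le_left _ _
    have hη2 : η ≤ (n - a) / 2 := min_le_right _ _
    set G := (max 1 C₁) ^ (n / δ) * (n * μ.real (Metric.ball (0:E) 1) *
      ((max 1 (2 * ρ)) ^ (n:ℝ) / η)) with hG
    have hG0 : 0 ≤ G := by positivity
    refine ⟨2 * (∫⁻ x, ‖C x‖ₑ ^ ((n + a) / δ) ∂μ).toReal * G * G * μ.real D, by positivity, ?_⟩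
    intro t ht k₁ k₂ h1 h2 h3
    have ht0 : 0 < t := by linarith
    have hJ : ∀ α : ℝ, 0 ≤ α → α ≤ n - η →
        ∫⁻ x in Metric.ball (0:E) (2 * (t * ρ)), ‖C x‖ₑ ^ (α / δ) ∂μ
          ≤ ENNReal.ofReal (G * t ^ (n - α)) := by
      intro α hα hα'
      refine (J_aux μ C C₁ δ hδ hC₁ hdecay α (2 * (t * ρ)) hα (by rw [hn]; linarith)
        (by positivity)).trans ?_
      apply ENNReal.ofReal_le_ofReal
      rw [hn]
      have e1 : (2 * (t * ρ)) ^ (n - α) = (2 * ρ) ^ (n - α) * t ^ (n - α) := by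
        rw [← Real.mul_rpow (by positivity) ht0.le]; congr 1; ring
      have e2 : (2 * ρ) ^ (n - α) ≤ (max 1 (2 * ρ)) ^ (n:ℝ) :=
        (Real.rpow_le_rpow (by positivity) (le_max_right 1 _) (by linarith)).trans
          (Real.rpow_le_rpow_of_exponent_le (le_max_left _ _) (by linarith))
      have e3 : C₁ ^ (α / δ) ≤ (max 1 C₁) ^ (n / δ) :=
        (Real.rpow_le_rpow (by positivity) (le_max_right 1 _) (by positivity)).trans
          (Real.rpow_le_rpow_of_exponent_le (le_max_left _ _) (by gcongr; linarith))
      rw [e1, hG]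
      calc C₁ ^ (α / δ) * (n * μ.real (Metric.ball (0:E) 1) *
              ((2 * ρ) ^ (n - α) * t ^ (n - α) / (n - α)))
          ≤ (max 1 C₁) ^ (n / δ) * (n * μ.real (Metric.ball (0:E) 1) *
              ((max 1 (2 * ρ)) ^ (n:ℝ) * t ^ (n - α) / η)) := by
            have e4 : 0 ≤ (n:ℝ) - α := by linarith
            gcongr
            linarith
        _ = _ := by ring
    have hk1 := hk _ h1
    have hk2 := hk _ h2
    have h3' : δ * m ≤ δ * k₁ + δ * k₂ := by
      rw [← mul_add]; gcongr; exact_mod_cast h3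
    have hsum : n + a ≤ min (δ * k₁) (n - η) + min (δ * k₂) (n - η) := by
      rcases min_cases (δ * k₁) (n - η) with ⟨h, _⟩ | ⟨h, _⟩ <;>
      rcases min_cases (δ * k₂) (n - η) with ⟨h', _⟩ | ⟨h', _⟩ <;> rw [h, h'] <;> linarith
    have hp1 : 0 ≤ min (δ * k₁) (n - η) := le_min (by positivity) (by linarith)
    have hp2 : 0 ≤ min (δ * k₂) (n - η) := le_min (by positivity) (by linarith)
    exact mid_aux μ C hC hCbdd δ hδ D hD ρ hDρ n hn a (hK _ (by linarith)) t ht k₁ k₂ _ _ _ _ G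
      hG0 hp1 hp2 (min_le_left _ _) (min_le_left _ _) hsum (by linarith)
      (hJ _ hp1 (min_le_right _ _)) (hJ _ hp2 (min_le_right _ _))

end helpers

/-- Polynomial decay of normalized contractions (Lemma 4.4). -/
theorem contraction_decay
    (d : ℕ) (hd : 1 ≤ d)
    (C : EuclideanSpace ℝ (Fin d) → ℝ)
    (hCmeas : Measurable C)
    (hCbdd : ∀ x, |C x| ≤ 1)
    (C₁ δ : ℝ) (hC₁ : 0 < C₁) (hδ : 0 < δ)
    (hdecay : ∀ x : EuclideanSpace ℝ (Fin d), x ≠ 0 → |C x| ≤ C₁ * ‖x‖ ^ (-δ))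
    (D : Set (EuclideanSpace ℝ (Fin d))) (hD : IsCompact D) (hDvol : 0 < volume D)
    (a : ℕ → ℝ) (hasum : Summable (fun q => a q ^ 2 * (q.factorial : ℝ)))
    (R : ℕ) (hR : 1 ≤ R) (haR : a R ≠ 0) (hrank : ∀ q, 1 ≤ q → q < R → a q = 0)
    (σ2 : ℝ → ℝ)
    (hσ2 : ∀ t : ℝ, σ2 t = ∑' q : ℕ,
      (if R ≤ q then a q ^ 2 * (q.factorial : ℝ) *
        (∫ x in t • D, ∫ y in t • D, C (x - y) ^ q) else 0))
    (t₀ c₀ : ℝ) (ht₀ : 0 < t₀) (hc₀ : 0 < c₀)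
    (hσlow : ∀ t, t₀ ≤ t → c₀ * t ^ (d : ℕ) ≤ σ2 t)
    (h : ℝ → ℕ → ℕ → ℝ)
    (hh : ∀ t k₁ k₂, h t k₁ k₂ =
      ∫ x in t • D, ∫ y in t • D, ∫ z in t • D, ∫ v in t • D,
        C (x - y) ^ k₁ * C (z - v) ^ k₁ * C (x - z) ^ k₂ * C (y - v) ^ k₂)
    (ξ : ℕ → ℝ → ℝ)
    (hξ : ∀ m t, ξ m t = sSup {u : ℝ | ∃ k₁ k₂ : ℕ,
      1 ≤ k₁ ∧ 1 ≤ k₂ ∧ m ≤ k₁ + k₂ ∧ u = Real.sqrt (h t k₁ k₂) / σ2 t}) :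
    ∀ m : ℕ, (d : ℝ) / δ < (m : ℝ) →
      0 < min (δ * m - d) (min (d : ℝ) (δ / 2)) ∧
      ∃ c : ℝ, ∃ t₁ : ℝ, ∀ t, t₁ ≤ t →
        ξ m t ^ 2 ≤ c * t ^ (-(min (δ * (m : ℝ) - (d : ℝ)) (min (d : ℝ) (δ / 2)))) := by
  intro m hm
  have hm' : (d:ℝ) < δ * m := by rw [div_lt_iff₀ hδ] at hm; linarith
  have hd' : (1:ℝ) ≤ d := by exact_mod_cast hd
  haveI : Nonempty (Fin d) := ⟨⟨0, hd⟩⟩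
  refine ⟨lt_min (by linarith) (lt_min (by linarith) (by linarith)), ?_⟩
  obtain ⟨M, hM0, hM⟩ := all_aux volume C hCmeas hCbdd C₁ δ hδ hC₁ hdecay D hD d (by simp) m hm' _ rfl
  set b := min (δ * (m : ℝ) - (d : ℝ)) (min (d : ℝ) (δ / 2)) with hb
  refine ⟨M / c₀ ^ 2, max 1 t₀, fun t ht => ?_⟩
  have ht1 : 1 ≤ t := (le_max_left _ _).trans ht
  have ht2 : t₀ ≤ t := (le_max_right _ _).trans ht
  have htp : 0 < t := by linarith
  have hσ := hσlow t ht2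
  have hσ0 : 0 < c₀ * t ^ d := by positivity
  have hnn : 0 ≤ ξ m t := by
    rw [hξ]
    apply Real.sSup_nonneg
    rintro _ ⟨k₁, k₂, -, -, -, rfl⟩
    exact div_nonneg (Real.sqrt_nonneg _) (hσ0.le.trans hσ)
  have hle : ξ m t ≤ Real.sqrt (M * t ^ (2 * d - b)) / (c₀ * t ^ d) := by
    rw [hξ]
    apply Real.sSup_le _ (by positivity)
    rintro _ ⟨k₁, k₂, h1, h2, h3, rfl⟩
    gcongr
    rw [hh]
    exact (le_abs_self _).trans (hM t ht1 k₁ k₂ h1 h2 h3)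
  calc ξ m t ^ 2 ≤ (Real.sqrt (M * t ^ (2 * d - b)) / (c₀ * t ^ d)) ^ 2 := by gcongr
    _ = M / c₀ ^ 2 * (t ^ (2 * d - b) / (t ^ d) ^ 2) := by
      rw [div_pow, Real.sq_sqrt (by positivity)]
      field_simp
    _ = _ := by
      congr 1
      rw [← pow_mul, ← Real.rpow_natCast, ← Real.rpow_sub htp]
      congr 1
      push_cast
      ring
end
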